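/- Let K be a perfect field, A a reduced commutative K-algebra, and L any field extension of K. Then A ⊗_K L is a reduced ring. -/

import Mathlib

open TensorProduct

theorem redField (M E L : Type*) [Field M] [Field E] [Field L] [Algebra E M] [Algebra E L] [Algebra.IsSeparable E L] [Algebra.EssFiniteType E L] : IsReduced (M ⊗[E] L) := by
  have := Algebra.FormallyUnramified.of_isSeparable E L
  exact Algebra.FormallyUnramified.isReduced_of_field M _

theorem domFrac (K R E F : Type*) [Field K] [CommRing R] [IsDomain R] [Field E] [Field F] [Algebra K R] [Algebra K E] [Algebra R E] [IsScalarTower K R E] [Algebra K F] [IsFractionRing R E] [IsDomain (R ⊗[K] F)] : IsDomain (E ⊗[K] F) := by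
  have h : IsDomain ((R ⊗[K] F) ⊗[R] E) := by
    refine IsLocalization.isDomain_of_le_nonZeroDivisors (M := Algebra.algebraMapSubmonoid (R ⊗[K] F) (nonZeroDivisors R)) (R := R ⊗[K] F) _ ?_
    rintro _ ⟨r, hr, rfl⟩
    apply mem_nonZeroDivisors_of_ne_zero
    have hi : Function.Injective (algebraMap R (R ⊗[K] F)) :=
      Algebra.TensorProduct.includeLeft_injective (S := R) (algebraMap K F).injective
    exact (map_ne_zero_iff _ hi).2 (nonZeroDivisors.ne_zero hr)
  exact ((Algebra.TensorProduct.cancelBaseChange K R R E F).symm.trans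
    (Algebra.TensorProduct.comm R E (R ⊗[K] F))).toMulEquiv.isDomain _

theorem prodRed (K A L : Type*) [Field K] [CommRing A] [Algebra K A] [IsReduced A] [Field L] [Algebra K L]
   (h : ∀ p : Ideal A, ∀ [p.IsPrime], IsReduced (p.ResidueField ⊗[K] L)) : IsReduced (A ⊗[K] L) := by
  constructor
  intro x hx
  let b := Module.Basis.ofVectorSpace K L
  have nat (p : Ideal A) [p.IsPrime] (i) : ((Algebra.TensorProduct.basis p.ResidueField b).repr (Algebra.TensorProduct.map (IsScalarTower.toAlgHom K A p.ResidueField) (AlgHom.id K L) x)) i = algebraMap A p.ResidueField ((Algebra.TensorProduct.basis A b).repr x i) := by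
    clear hx
    induction x with
    | zero => simp
    | add x y hx hy => simp [hx, hy]
    | tmul a l => simp [Algebra.TensorProduct.basis_repr_tmul, ← IsScalarTower.algebraMap_apply, Algebra.smul_def]
  apply (Algebra.TensorProduct.basis A b).repr.injective
  ext i
  simp only [map_zero, Finsupp.coe_zero, Pi.zero_apply]
  apply IsNilpotent.eq_zero
  rw [← mem_nilradical, nilradical_eq_sInf, Ideal.mem_sInf]
  intro p hp
  have : p.IsPrime := hp
  have := h p
  rw [← Ideal.algebraMap_residueField_eq_zero, ← nat p i, (hx.map _).eq_zero]
  simp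

theorem towRed (K E F L : Type*) [Field K] [Field E] [Field F] [Field L] [Algebra K F] [Algebra K L]
    [Algebra K E] [Algebra E L] [IsScalarTower K E L] [Algebra.IsSeparable E L]
    [Algebra.EssFiniteType K L] [IsDomain (E ⊗[K] F)] : IsReduced (F ⊗[K] L) := by
  let M := FractionRing (E ⊗[K] F)
  have : Algebra.EssFiniteType E L := Algebra.EssFiniteType.of_comp K E L
  have : IsReduced (M ⊗[E] L) := redField M E L
  have h1 : IsReduced ((E ⊗[K] F) ⊗[E] L) :=
    isReduced_of_injective (Algebra.TensorProduct.map (IsScalarTower.toAlgHom E (E ⊗[K] F) M) (AlgHom.id E L))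
      (Module.Flat.rTensor_preserves_injective_linearMap (M := L)
        (IsScalarTower.toAlgHom E (E ⊗[K] F) M).toLinearMap (IsFractionRing.injective _ M))
  let e' := ((Algebra.TensorProduct.comm E (E ⊗[K] F) L).trans
    (Algebra.TensorProduct.cancelBaseChange K E E L F)).restrictScalars K |>.trans
    (Algebra.TensorProduct.comm K L F)
  exact isReduced_of_injective e'.symm e'.symm.injective

open scoped IntermediateField.algebraAdjoinAdjoin in
theorem essRed (K F L : Type*) [Field K] [PerfectField K] [Field F] [Field L] [Algebra K F] [Algebra K L]
    [Algebra.EssFiniteType K L] : IsReduced (F ⊗[K] L) := by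
  obtain ⟨s, hs, hsep⟩ := exists_isTranscendenceBasis_and_isSeparable_of_perfectField K L
  let E := IntermediateField.adjoin K (s : Set L)
  let R := Algebra.adjoin K (s : Set L)
  have e : MvPolynomial s K ≃ₐ[K] R :=
    hs.1.aevalEquiv.trans (Subalgebra.equivOfEq _ _ (by simp [R]))
  have : IsDomain (R ⊗[K] F) :=
    ((Algebra.TensorProduct.comm K R F).trans
      ((Algebra.TensorProduct.congr AlgEquiv.refl e.symm).trans
      ((MvPolynomial.algebraTensorAlgEquiv K F).restrictScalars K))).toMulEquiv.isDomain _
  have : IsDomain (E ⊗[K] F) := domFrac K R E F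
  exact towRed K E F L

/-- Over a perfect field `K`, the base change `A ⊗_K L` of a reduced `K`-algebra `A` to any
field extension `L` is reduced. -/
theorem stmt_12 (K : Type*) [Field K] [PerfectField K]
    (A : Type*) [CommRing A] [Algebra K A] [IsReduced A]
    (L : Type*) [Field L] [Algebra K L] :
    IsReduced (A ⊗[K] L) := by
  apply prodRed
  intro p _
  apply IsReduced.tensorProduct_of_flat_of_forall_fg
  rintro B ⟨s, rfl⟩
  have : Algebra.EssFiniteType K (IntermediateField.adjoin K (s : Set L)) :=
    IntermediateField.essFiniteType_iff.2 ⟨s, rfl⟩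
  have := essRed K p.ResidueField (IntermediateField.adjoin K (s : Set L))
  let f : Algebra.adjoin K (s : Set L) →ₐ[K] IntermediateField.adjoin K (s : Set L) :=
    Subalgebra.inclusion (IntermediateField.algebra_adjoin_le_adjoin K _)
  exact isReduced_of_injective (Algebra.TensorProduct.map (AlgHom.id K p.ResidueField) f)
    (Module.Flat.lTensor_preserves_injective_linearMap (M := p.ResidueField) f.toLinearMap
      (Subalgebra.inclusion_injective
        (IntermediateField.algebra_adjoin_le_adjoin K _)))
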